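/- For every factor u of a Sturmian word and every integer l ≥ 2, the abelian class of u has at most one abelian return of length l. -/

import Mathlib

/-- The factor of length `n` of the infinite word `w` starting at position `i`. -/
def wordAt {α : Type*} (w : ℕ → α) (i n : ℕ) : List α :=
  (List.range n).map (fun k => w (i + k))

/-- `u` is a factor of the infinite word `w`. -/
def IsFactorW {α : Type*} (w : ℕ → α) (u : List α) : Prop :=
  ∃ i, u = wordAt w i u.length

/-- `w` is recurrent: every factor occurs infinitely often. -/
def RecurrentW {α : Type*} (w : ℕ → α) : Prop :=
  ∀ u, IsFactorW w u → ∀ N, ∃ i, N ≤ i ∧ u = wordAt w i u.length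

/-- `w` is (purely) periodic. -/
def PeriodicW {α : Type*} (w : ℕ → α) : Prop :=
  ∃ T, 0 < T ∧ ∀ n, w (n + T) = w n

/-- `w` is ultimately periodic. -/
def UltPeriodicW {α : Type*} (w : ℕ → α) : Prop :=
  ∃ T, 0 < T ∧ ∃ n₀, ∀ n, n₀ ≤ n → w (n + T) = w n

/-- Two finite words are abelian equivalent: same number of occurrences of each letter. -/
def AbEquiv {α : Type*} [DecidableEq α] (u v : List α) : Prop :=
  ∀ a : α, u.count a = v.count a

/-- Positions of occurrences of words abelian equivalent to `u` in `w`. -/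
def abOcc {α : Type*} [DecidableEq α] (w : ℕ → α) (u : List α) : Set ℕ :=
  {i | AbEquiv (wordAt w i u.length) u}

/-- The semi-abelian returns to (the abelian class of) `u` in `w`: words extending from one
occurrence of the abelian class of `u` to the next one. -/
def semiAbReturns {α : Type*} [DecidableEq α] (w : ℕ → α) (u : List α) : Set (List α) :=
  {r | ∃ i j, i ∈ abOcc w u ∧ j ∈ abOcc w u ∧ i < j ∧
      (∀ k, i < k → k < j → k ∉ abOcc w u) ∧ r = wordAt w i (j - i)}

/-- Positions of (exact) occurrences of `u` in `w`. -/
def occW {α : Type*} [DecidableEq α] (w : ℕ → α) (u : List α) : Set ℕ :=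
  {i | u = wordAt w i u.length}

/-- The ordinary return words of `u` in `w`. -/
def returnWords {α : Type*} [DecidableEq α] (w : ℕ → α) (u : List α) : Set (List α) :=
  {r | ∃ i j, i ∈ occW w u ∧ j ∈ occW w u ∧ i < j ∧
      (∀ k, i < k → k < j → k ∉ occW w u) ∧ r = wordAt w i (j - i)}

/-- `u` has exactly `k` semi-abelian returns in `w`. -/
def ExactlyKSemiAbReturns {α : Type*} [DecidableEq α] (w : ℕ → α) (u : List α) (k : ℕ) : Prop :=
  ∃ f : Fin k → List α, Function.Injective f ∧ semiAbReturns w u = Set.range f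

/-- `u` has exactly `k` abelian returns in `w`: there are `k` pairwise non-abelian-equivalent
representatives so that every semi-abelian return is abelian equivalent to exactly one of them,
and each representative is realized. -/
def ExactlyKAbReturns {α : Type*} [DecidableEq α] (w : ℕ → α) (u : List α) (k : ℕ) : Prop :=
  ∃ f : Fin k → List α,
    (∀ i j, AbEquiv (f i) (f j) → i = j) ∧
    (∀ r ∈ semiAbReturns w u, ∃ i, AbEquiv r (f i)) ∧
    (∀ i, ∃ r ∈ semiAbReturns w u, AbEquiv r (f i))

/-- `u` has at most `k` abelian returns in `w`. -/
def AtMostKAbReturns {α : Type*} [DecidableEq α] (w : ℕ → α) (u : List α) (k : ℕ) : Prop :=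
  ∃ f : Fin k → List α, ∀ r ∈ semiAbReturns w u, ∃ i, AbEquiv r (f i)

/-- `u` has at least `k` abelian returns in `w`. -/
def AtLeastKAbReturns {α : Type*} [DecidableEq α] (w : ℕ → α) (u : List α) (k : ℕ) : Prop :=
  ∃ f : Fin k → List α,
    (∀ i j, AbEquiv (f i) (f j) → i = j) ∧
    (∀ i, ∃ r ∈ semiAbReturns w u, AbEquiv r (f i))

/-- `u` has at least two semi-abelian returns in `w`. -/
def AtLeastTwoSemiAbReturns {α : Type*} [DecidableEq α] (w : ℕ → α) (u : List α) : Prop :=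
  ∃ r₁ r₂, r₁ ∈ semiAbReturns w u ∧ r₂ ∈ semiAbReturns w u ∧ r₁ ≠ r₂

/-- The factor complexity of `w`. -/
noncomputable def complexityW {α : Type*} (w : ℕ → α) (n : ℕ) : ℕ :=
  {u : List α | u.length = n ∧ IsFactorW w u}.ncard

/-- A Sturmian word: aperiodic binary word with factor complexity `n + 1`. -/
def SturmianW (w : ℕ → Bool) : Prop :=
  ¬ UltPeriodicW w ∧ ∀ n, complexityW w n = n + 1

/-- Right special factor of a binary word. -/
def RightSpecial (w : ℕ → Bool) (B : List Bool) : Prop :=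
  IsFactorW w (B ++ [false]) ∧ IsFactorW w (B ++ [true])

/-- Left special factor of a binary word. -/
def LeftSpecial (w : ℕ → Bool) (B : List Bool) : Prop :=
  IsFactorW w (false :: B) ∧ IsFactorW w (true :: B)

/-- Bispecial factor of a binary word. -/
def Bispecial (w : ℕ → Bool) (B : List Bool) : Prop :=
  RightSpecial w B ∧ LeftSpecial w B

/-- `w` is `c`-balanced. -/
def CBalanced {α : Type*} [DecidableEq α] (w : ℕ → α) (c : ℕ) : Prop :=
  ∀ u v : List α, IsFactorW w u → IsFactorW w v → u.length = v.length →
    ∀ a : α, |((u.count a : ℤ) - (v.count a : ℤ))| ≤ (c : ℤ)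

/-- The number of occurrences of `true` in the factor of length `n` at position `i`. -/
def onesAt (w : ℕ → Bool) (i n : ℕ) : ℤ :=
  ((wordAt w i n).count true : ℤ)

section wordAt

variable {α : Type*} (w : ℕ → α)

@[simp]
theorem length_wordAt (i n : ℕ) : (wordAt w i n).length = n := by
  simp [wordAt]

theorem wordAt_succ (i n : ℕ) : wordAt w i (n + 1) = wordAt w i n ++ [w (i + n)] := by
  simp [wordAt, List.range_succ]

theorem wordAt_add (i m n : ℕ) : wordAt w i (m + n) = wordAt w i m ++ wordAt w (i + m) n := by
  simp [wordAt, List.range_add, add_assoc]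

theorem wordAt_one (i : ℕ) : wordAt w i 1 = [w i] := by
  simp [wordAt]

theorem wordAt_eq_iff (i j n : ℕ) :
    wordAt w i n = wordAt w j n ↔ ∀ k < n, w (i + k) = w (j + k) := by
  simp [wordAt]

theorem isFactorW_wordAt (i n : ℕ) : IsFactorW w (wordAt w i n) :=
  ⟨i, by simp⟩

theorem isFactorW_append_singleton_iff (B : List α) (b : α) :
    IsFactorW w (B ++ [b]) ↔ ∃ i, B = wordAt w i B.length ∧ w (i + B.length) = b := by
  unfold IsFactorW
  refine exists_congr fun i => ?_
  rw [List.length_append, List.length_singleton, wordAt_succ]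
  constructor
  · intro h
    obtain ⟨h1, h2⟩ := List.append_inj h (by simp)
    exact ⟨h1, by simpa using h2.symm⟩
  · rintro ⟨h1, h2⟩
    rw [← h1, h2]

end wordAt

section onesAt

variable (w : ℕ → Bool)

theorem onesAt_zero (i : ℕ) : onesAt w i 0 = 0 := by
  simp [onesAt, wordAt]

theorem onesAt_add (i m n : ℕ) : onesAt w i (m + n) = onesAt w i m + onesAt w (i + m) n := by
  simp [onesAt, wordAt_add]

theorem onesAt_one (i : ℕ) : onesAt w i 1 = if w i then 1 else 0 := by
  cases h : w i <;> simp [onesAt, wordAt_one, h]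

theorem onesAt_succ (i n : ℕ) :
    onesAt w i (n + 1) = onesAt w i n + if w (i + n) then 1 else 0 := by
  rw [onesAt_add, onesAt_one]

theorem onesAt_succ' (i n : ℕ) :
    onesAt w i (n + 1) = (if w i then 1 else 0) + onesAt w (i + 1) n := by
  rw [add_comm n, onesAt_add, onesAt_one]

theorem abEquiv_iff_of_length_eq {u v : List Bool} (h : u.length = v.length) :
    AbEquiv u v ↔ u.count true = v.count true := by
  have hu := List.count_true_add_count_false u
  have hv := List.count_true_add_count_false v
  unfold AbEquiv
  rw [Bool.forall_bool]
  omega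

end onesAt

section special

variable {w : ℕ → Bool}

theorem rightSpecial_wordAt {i j n : ℕ} (h : ∀ k < n, w (i + k) = w (j + k))
    (hn : w (i + n) ≠ w (j + n)) : RightSpecial w (wordAt w i n) := by
  have h' := (wordAt_eq_iff w i j n).2 h
  have H : ∀ b, IsFactorW w (wordAt w i n ++ [b]) := by
    intro b
    rw [isFactorW_append_singleton_iff]
    by_cases hb : w (i + n) = b
    · exact ⟨i, by simpa using hb⟩
    · refine ⟨j, by simpa using h', ?_⟩
      rw [length_wordAt]
      revert hn hb
      cases w (i + n) <;> cases w (j + n) <;> cases b <;> simp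
  exact ⟨H _, H _⟩

/-- A word of complexity `n + 1` has exactly one right special factor of each length. -/
theorem exists_rightSpecial_iff (hw : ∀ n, complexityW w n = n + 1) (n : ℕ) :
    ∃ A : List Bool, ∀ B, B.length = n ∧ RightSpecial w B ↔ B = A := by
  set E : Bool → Set (List Bool) := fun b => {B | B.length = n ∧ IsFactorW w (B ++ [b])} with hE
  have fin : ∀ m, {u : List Bool | u.length = m ∧ IsFactorW w u}.Finite := fun m => by
    apply Set.finite_of_ncard_ne_zero
    have := hw m
    unfold complexityW at this
    omega
  have hunion : E false ∪ E true = {u | u.length = n ∧ IsFactorW w u} := by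
    ext B
    simp only [hE, Set.mem_union, Set.mem_ofPred_eq, isFactorW_append_singleton_iff]
    constructor
    · rintro (⟨hB, i, hi, -⟩ | ⟨hB, i, hi, -⟩) <;> exact ⟨hB, i, hi⟩
    · rintro ⟨hB, i, hi⟩
      cases h : w (i + B.length)
      · exact Or.inl ⟨hB, i, hi, h⟩
      · exact Or.inr ⟨hB, i, hi, h⟩
  have hfin : ∀ b, (E b).Finite := by
    intro b
    refine (fin n).subset ?_
    rw [← hunion]
    cases b
    · exact Set.subset_union_left
    · exact Set.subset_union_right
  have hsucc : ((fun B => B ++ [false]) '' E false) ∪ ((fun B => B ++ [true]) '' E true)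
      = {u | u.length = n + 1 ∧ IsFactorW w u} := by
    ext B
    simp only [hE, Set.mem_union, Set.mem_image, Set.mem_ofPred_eq]
    constructor
    · rintro (⟨A, ⟨hA, hf⟩, rfl⟩ | ⟨A, ⟨hA, hf⟩, rfl⟩) <;> exact ⟨by simp [hA], hf⟩
    · rintro ⟨hB, hf⟩
      rcases List.eq_nil_or_concat' B with rfl | ⟨A, b, rfl⟩
      · simp at hB
      · have hA : A.length = n := by simpa using hB
        cases b
        · exact Or.inl ⟨A, ⟨hA, hf⟩, rfl⟩
        · exact Or.inr ⟨A, ⟨hA, hf⟩, rfl⟩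
  have hdisj : Disjoint ((fun B => B ++ [false]) '' E false)
      ((fun B => B ++ [true]) '' E true) := by
    rw [Set.disjoint_left]
    rintro _ ⟨A, -, rfl⟩ ⟨B, -, h⟩
    simpa using congrArg List.getLast? h
  have h1 := Set.ncard_union_add_ncard_inter (E false) (E true) (hfin _) (hfin _)
  have h2 := Set.ncard_union_eq hdisj ((hfin _).image _) ((hfin _).image _)
  rw [hsucc, Set.ncard_image_of_injective _ (List.append_left_injective _),
    Set.ncard_image_of_injective _ (List.append_left_injective _)] at h2
  rw [hunion] at h1
  have h3 := hw n
  have h4 := hw (n + 1)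
  unfold complexityW at h3 h4
  obtain ⟨A, hA⟩ := Set.ncard_eq_one.1 (show (E false ∩ E true).ncard = 1 by omega)
  refine ⟨A, fun B => ?_⟩
  rw [← Set.mem_singleton_iff (b := A), ← hA]
  simp only [hE, RightSpecial, Set.mem_inter_iff, Set.mem_ofPred_eq]
  tauto

/-- If a factor recurs and no right special factor of the same length is met in between, then the
word is ultimately periodic. -/
theorem ultPeriodicW_of_not_rightSpecial {a b n : ℕ} (hab : a < b)
    (h : wordAt w a n = wordAt w b n)
    (hs : ∀ k, a ≤ k → k < b → ¬ RightSpecial w (wordAt w k n)) : UltPeriodicW w := by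
  have key : ∀ k, wordAt w (a + k) n = wordAt w (b + k) n ∧
      ¬ RightSpecial w (wordAt w (a + k) n) := by
    intro k
    induction k using Nat.strong_induction_on with
    | _ k ih =>
      refine ⟨?_, ?_⟩
      · rcases k with _ | k
        · simpa using h
        · obtain ⟨h1, h2⟩ := ih k (by omega)
          rw [wordAt_eq_iff] at h1 ⊢
          intro t ht
          by_cases hn : w (a + k + n) = w (b + k + n)
          · rcases Nat.lt_or_ge (t + 1) n with h' | h'
            · convert h1 (t + 1) h' using 2 <;> omega
            · obtain rfl : n = t + 1 := by omega
              convert hn using 2 <;> omega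
          · exact absurd (rightSpecial_wordAt h1 hn) h2
      · rcases Nat.lt_or_ge k (b - a) with hk | hk
        · exact hs _ (by omega) (by omega)
        · obtain ⟨h1, h2⟩ := ih (k - (b - a)) (by omega)
          rwa [h1, show b + (k - (b - a)) = a + k by omega] at h2
  refine ⟨b - a, by omega, a + n, fun m hm => ?_⟩
  by_contra hne
  obtain ⟨h1, h2⟩ := key (m - n - a)
  refine h2 (rightSpecial_wordAt ((wordAt_eq_iff ..).1 h1) ?_)
  rw [show a + (m - n - a) + n = m by omega, show b + (m - n - a) + n = m + (b - a) by omega]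
  exact Ne.symm hne

end special

section balance

variable {w : ℕ → Bool}

/-- An unbalanced word contains factors `1v1` and `0v0` with `v` a palindrome. -/
theorem exists_palindrome_of_unbalanced
    (h : ∃ m i j, onesAt w j m + 2 ≤ onesAt w i m) :
    ∃ n i j, w i = true ∧ w (i + n + 1) = true ∧ w j = false ∧ w (j + n + 1) = false ∧
      (∀ k < n, w (i + 1 + k) = w (j + 1 + k)) ∧
      ∀ a b, a + b + 1 = n → w (i + 1 + a) = w (i + 1 + b) := by
  classical
  obtain ⟨i, j, hij⟩ := Nat.find_spec h
  have hmin : ∀ k < Nat.find h, ∀ i j, onesAt w i k ≤ onesAt w j k + 1 := by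
    intro k hk i j
    have := Nat.find_min h hk
    push Not at this
    have := this i j
    omega
  generalize Nat.find h = m at hij hmin
  have first : ∀ i j, onesAt w j m + 2 ≤ onesAt w i m → 0 < m := by
    intro i j hij
    rcases m with _ | m
    · simp [onesAt_zero] at hij
    · omega
  obtain ⟨m, rfl⟩ : ∃ m', m = m' + 1 := ⟨m - 1, by have := first i j hij; omega⟩
  have hl : w i = true ∧ w j = false := by
    have h1 := hmin m (by omega) (i + 1) (j + 1)
    rw [onesAt_succ', onesAt_succ'] at hij
    revert hij
    cases w i <;> cases w j <;> simp <;> omega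
  have hr : w (i + m) = true ∧ w (j + m) = false := by
    have h1 := hmin m (by omega) i j
    rw [onesAt_succ, onesAt_succ] at hij
    revert hij
    cases w (i + m) <;> cases w (j + m) <;> simp <;> omega
  obtain ⟨n, rfl⟩ : ∃ n, m = n + 1 := by
    rcases m with _ | m
    · simp [onesAt_one, hl] at hij
    · exact ⟨m, rfl⟩
  have pre : ∀ k ≤ n, onesAt w (i + 1) k = onesAt w (j + 1) k := by
    intro k hk
    have h1 := hmin (k + 1) (by omega) i j
    have h2 := hmin (n + 1 - k) (by omega) (i + 1 + k) (j + 1 + k)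
    rw [onesAt_succ' w i, onesAt_succ' w j, hl.1, hl.2] at h1
    rw [onesAt_succ' w i, onesAt_succ' w j, hl.1, hl.2, show n + 1 = k + (n + 1 - k) by omega,
      onesAt_add, onesAt_add] at hij
    simp at hij h1
    omega
  have eqv : ∀ k < n, w (i + 1 + k) = w (j + 1 + k) := by
    intro k hk
    have h1 := pre k (by omega)
    have h2 := pre (k + 1) (by omega)
    rw [onesAt_succ, onesAt_succ] at h2
    revert h2
    cases w (i + 1 + k) <;> cases w (j + 1 + k) <;> simp <;> omega
  have suf : ∀ a b, a + b = n → onesAt w (i + 1) a = onesAt w (i + 1 + b) a := by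
    intro a b hab
    have h1 := hmin (a + 1) (by omega) i (j + 1 + b)
    have h2 := hmin (a + 1) (by omega) (i + 1 + b) j
    rw [onesAt_succ', onesAt_succ, hl.1,
      show j + 1 + b + a = j + (n + 1) by omega, hr.2] at h1
    rw [onesAt_succ, onesAt_succ' w j, hl.2,
      show i + 1 + b + a = i + (n + 1) by omega, hr.1] at h2
    have h3 := pre n le_rfl
    have h4 := pre b (by omega)
    have h5 := pre a (by omega)
    rw [← hab, add_comm a, onesAt_add, onesAt_add] at h3
    simp at h1 h2
    omega
  refine ⟨n, i, j, hl.1, hr.1, hl.2, hr.2, eqv, fun a b hab => ?_⟩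
  have h1 := suf a (b + 1) (by omega)
  have h2 := suf (a + 1) b (by omega)
  rw [onesAt_succ, onesAt_succ'] at h2
  rw [show i + 1 + b + 1 = i + 1 + (b + 1) by omega] at h2
  revert h2
  cases w (i + 1 + a) <;> cases w (i + 1 + b) <;> simp <;> omega

/-- Sturmian words are balanced. -/
theorem SturmianW.onesAt_le (hw : SturmianW w) (m i j : ℕ) :
    onesAt w i m ≤ onesAt w j m + 1 := by
  by_contra hlt
  obtain ⟨n, i, j, hi, hi', hj, hj', heq, hpal⟩ :=
    exists_palindrome_of_unbalanced (w := w) ⟨m, i, j, by omega⟩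
  clear hlt
  obtain ⟨V, hV⟩ := exists_rightSpecial_iff hw.2 n
  obtain ⟨A, hA⟩ := exists_rightSpecial_iff hw.2 (n + 1)
  have hVi : wordAt w (i + 1) n = V := by
    refine (hV _).1 ⟨by simp, rightSpecial_wordAt heq ?_⟩
    rw [show i + 1 + n = i + n + 1 by omega, show j + 1 + n = j + n + 1 by omega, hi', hj']
    simp
  obtain ⟨hAlen, hAs⟩ := (hA A).2 rfl
  obtain ⟨q, hq, hqf⟩ := (isFactorW_append_singleton_iff w A _).1 hAs.1
  obtain ⟨q', hq', hqt⟩ := (isFactorW_append_singleton_iff w A _).1 hAs.2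
  rw [hAlen] at hq hq' hqf hqt
  have hqq : ∀ k < n + 1, w (q + k) = w (q' + k) := (wordAt_eq_iff ..).1 (hq.symm.trans hq')
  have hVq : wordAt w (q + 1) n = V := by
    refine (hV _).1 ⟨by simp, rightSpecial_wordAt (j := q' + 1) (fun k hk => ?_) ?_⟩
    · convert hqq (k + 1) (by omega) using 2 <;> omega
    · rw [show q + 1 + n = q + (n + 1) by omega, show q' + 1 + n = q' + (n + 1) by omega, hqf, hqt]
      simp
  have hiq : ∀ k < n, w (q + 1 + k) = w (i + 1 + k) :=
    (wordAt_eq_iff ..).1 (hVq.trans hVi.symm)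
  obtain ⟨p, hp, hp', hpq, hpp⟩ : ∃ p, w p ≠ w q ∧ w (p + n + 1) ≠ w q ∧
      (∀ k < n, w (q + 1 + k) = w (p + 1 + k)) ∧
      ∀ a b, a + b + 1 = n → w (p + 1 + a) = w (p + 1 + b) := by
    cases hc : w q
    · exact ⟨i, by simp [hi], by simp [hi'], hiq, hpal⟩
    · refine ⟨j, by simp [hj], by simp [hj'], fun k hk => (hiq k hk).trans (heq k hk),
        fun a b hab => ?_⟩
      rw [← heq a (by omega), ← heq b (by omega), hpal a b hab]
  have avoid : ∀ k < n + 2, wordAt w (p + k) (n + 1) ≠ A := by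
    intro k hk h
    rw [hq, wordAt_eq_iff] at h
    have h0 : w (p + k) = w q := by simpa using h 0 (by omega)
    rcases k with _ | k
    · exact hp h0
    · rcases Nat.lt_or_ge k n with hkn | hkn
      · have h1 := h (n - k) (by omega)
        have h2 := hpq (n - k - 1) (by omega)
        have h3 := hpp (n - k - 1) k (by omega)
        rw [show p + (k + 1) + (n - k) = p + n + 1 by omega] at h1
        rw [show q + 1 + (n - k - 1) = q + (n - k) by omega] at h2
        rw [show p + 1 + k = p + (k + 1) by omega] at h3
        exact hp' (h1.trans (h2.trans (h3.trans h0)))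
      · obtain rfl : k = n := by omega
        exact hp' h0
  have hcard := hw.2 (n + 1)
  unfold complexityW at hcard
  set F := {u : List Bool | u.length = n + 1 ∧ IsFactorW w u} with hF
  have hFfin : F.Finite := Set.finite_of_ncard_ne_zero (by omega)
  have hAF : A ∈ F := ⟨hAlen, q, by rw [hAlen]; exact hq⟩
  have hcard' : (F \ {A}).ncard < (Finset.range (n + 2) : Set ℕ).ncard := by
    rw [Set.ncard_sdiff_singleton_of_mem hAF, Set.ncard_coe_finset, Finset.card_range]
    omega
  obtain ⟨a, ha, b, hb, hab, hwab⟩ := Set.exists_ne_map_eq_of_ncard_lt_of_maps_to hcard'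
    (f := fun k => wordAt w (p + k) (n + 1))
    (fun k hk => ⟨⟨by simp, isFactorW_wordAt ..⟩, avoid k (by simpa using hk)⟩) (hFfin.sdiff)
  simp only [Finset.coe_range, Set.mem_Iio] at ha hb
  have noSpecial : ∀ k, p ≤ k → k < p + (n + 2) → ¬ RightSpecial w (wordAt w k (n + 1)) := by
    intro k hk hk' hs
    refine avoid (k - p) (by omega) ((hA _).1 ⟨by simp, ?_⟩)
    rwa [show p + (k - p) = k by omega]
  rcases Nat.lt_or_gt_of_ne hab with hlt | hlt
  · exact hw.1 (ultPeriodicW_of_not_rightSpecial (a := p + a) (b := p + b) (by omega) hwab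
      fun k h1 h2 => noSpecial k (by omega) (by omega))
  · exact hw.1 (ultPeriodicW_of_not_rightSpecial (a := p + b) (b := p + a) (by omega) hwab.symm
      fun k h1 h2 => noSpecial k (by omega) (by omega))

/-- A semi-abelian return of length at least two to a factor of a Sturmian word has the form `axb`
with `a ≠ b`, and `bxa` is a factor as well; in terms of positions, both letters precede an
occurrence of a word with as many ones as `x`. -/
theorem SturmianW.exists_of_mem_semiAbReturns (hw : SturmianW w) {u r : List Bool}
    {m : ℕ} (hr : r ∈ semiAbReturns w u) (hm : r.length = m + 2) :
    ∃ i j, w i = true ∧ w j = false ∧ onesAt w (i + 1) m = onesAt w (j + 1) m ∧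
      (r.count true : ℤ) = onesAt w (i + 1) m + 1 := by
  obtain ⟨i, j, hi, hj, hij, hk, rfl⟩ := hr
  rw [length_wordAt] at hm
  obtain rfl : j = i + (m + 2) := by omega
  rw [hm]
  set n := u.length with hn
  have occ : ∀ k, k ∈ abOcc w u ↔ onesAt w k n = (u.count true : ℤ) := by
    intro k
    unfold abOcc
    rw [Set.mem_ofPred_eq, abEquiv_iff_of_length_eq (by simp)]
    simp [onesAt, hn]
  rw [occ] at hi hj
  have hk' : ∀ k, i < k → k < i + (m + 2) → onesAt w k n ≠ (u.count true : ℤ) :=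
    fun k h1 h2 h => hk k h1 h2 ((occ k).2 h)
  have step : ∀ k, (if w k then 1 else 0) + onesAt w (k + 1) n =
      onesAt w k n + if w (k + n) then 1 else 0 := fun k => by
    rw [← onesAt_succ, ← onesAt_succ']
  have inner : onesAt w (i + m + 1) n = onesAt w (i + 1) n := by
    have a1 := hw.onesAt_le n (i + m + 1) (i + 1)
    have a2 := hw.onesAt_le n (i + 1) (i + m + 1)
    have b1 := hw.onesAt_le n (i + m + 1) i
    have b2 := hw.onesAt_le n i (i + m + 1)
    have c1 := hw.onesAt_le n i (i + 1)
    have c2 := hw.onesAt_le n (i + 1) i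
    have d1 := hk' (i + 1) (by omega) (by omega)
    have d2 := hk' (i + m + 1) (by omega) (by omega)
    omega
  have mid : onesAt w (i + 1) m = onesAt w (i + n + 1) m := by
    have h1 := onesAt_add w (i + 1) m n
    have h2 := onesAt_add w (i + 1) n m
    rw [add_comm m n] at h1
    rw [show i + 1 + m = i + m + 1 by omega] at h1
    rw [show i + 1 + n = i + n + 1 by omega] at h2
    omega
  have s1 := step i
  have s2 := step (i + m + 1)
  have d1 := hk' (i + 1) (by omega) (by omega)
  have hj' : onesAt w (i + m + 1 + 1) n = (u.count true : ℤ) := hj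
  have hcount : ((wordAt w i (m + 2)).count true : ℤ) =
      (if w i then 1 else 0) + (onesAt w (i + 1) m + if w (i + m + 1) then 1 else 0) := by
    rw [show i + m + 1 = i + 1 + m by omega, ← onesAt_succ, ← onesAt_succ']
    rfl
  rw [hcount]
  rw [inner, hj'] at s2
  rw [hi] at s1
  cases h1 : w i <;> cases h2 : w (i + n) <;> cases h3 : w (i + m + 1) <;>
    simp only [h1, h2, h3, if_true, if_false, Bool.false_eq_true] at s1 s2 ⊢
  all_goals first
    | (exfalso; omega)
    | (exfalso; split_ifs at s2 <;> omega)
    | exact ⟨i + n, i, h2, h1, mid.symm, by omega⟩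
    | exact ⟨i, i + n, h1, h2, mid, by omega⟩

end balance

/-- Every factor of a Sturmian word has at most one abelian return of each length `l ≥ 2`. -/
theorem stmt6 (w : ℕ → Bool) (hst : SturmianW w) (u : List Bool)
    (hu : IsFactorW w u) (hne : u ≠ []) :
    ∀ l : ℕ, 2 ≤ l →
      ∀ r₁ ∈ semiAbReturns w u, ∀ r₂ ∈ semiAbReturns w u,
        r₁.length = l → r₂.length = l → AbEquiv r₁ r₂ := by
  intro l hl r₁ h₁ r₂ h₂ hl₁ hl₂
  obtain ⟨m, rfl⟩ : ∃ m, l = m + 2 := ⟨l - 2, by omega⟩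
  rw [abEquiv_iff_of_length_eq (hl₁.trans hl₂.symm)]
  obtain ⟨i, j, hi, hj, hij, hc⟩ := hst.exists_of_mem_semiAbReturns h₁ hl₁
  obtain ⟨i', j', hi', hj', hij', hc'⟩ := hst.exists_of_mem_semiAbReturns h₂ hl₂
  have b₁ := hst.onesAt_le (m + 1) i j'
  have b₂ := hst.onesAt_le (m + 1) i' j
  simp only [onesAt_succ', hi, hj, hi', hj', if_true, if_false, Bool.false_eq_true] at b₁ b₂
  omega
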